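/- Let n ≥ 1 and let u be an n×n complex unitary matrix. Then u is symmetric (uᵀ = u) if and only if there exists an n×n complex unitary matrix v with u = v·vᵀ. (This expresses the triviality of H¹(Z/2; U(n)) for the action of Z/2 on U(n) by entrywise complex conjugation: σ(u) = u⁻¹ if and only if u = v·σ(v⁻¹) for some unitary v.) -/

import Mathlib

open scoped Matrix.Norms.L2Operator in
theorem exists_sqrt_aux (n : ℕ) (u : Matrix (Fin n) (Fin n) ℂ)
    (hu : u ∈ Matrix.unitaryGroup (Fin n) ℂ) :
    ∃ p : Polynomial ℂ, Polynomial.aeval u p ∈ Matrix.unitaryGroup (Fin n) ℂ ∧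
      Polynomial.aeval u p * Polynomial.aeval u p = u := by
  classical
  have hN : IsStarNormal u := ⟨by
    have h1 := Unitary.star_mul_self_of_mem hu
    have h2 := Unitary.mul_star_self_of_mem hu
    rw [Commute, SemiconjBy, h1, h2]⟩
  have hfin : (spectrum ℂ u).Finite := Matrix.finite_spectrum u
  have hsq : ∀ z : ℂ, ∃ w : ℂ, w * w = z := fun z => by
    obtain ⟨w, hw⟩ := IsAlgClosed.exists_eq_mul_self z
    exact ⟨w, hw.symm⟩
  choose f hf using hsq
  let p := Lagrange.interpolate hfin.toFinset id f
  have hp : ∀ z ∈ spectrum ℂ u, p.eval z = f z := fun z hz =>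
    Lagrange.eval_interpolate_at_node (v := id) f (Function.injective_id.injOn)
      (hfin.mem_toFinset.2 hz)
  have hc : cfc (fun z => p.eval z) u = Polynomial.aeval u p := cfc_polynomial p u
  refine ⟨p, ?_, ?_⟩
  · rw [← hc]
    refine (cfc_unitary_iff _ u).2 fun z hz => ?_
    have hz1 : ‖z‖ = 1 := by
      simpa using spectrum.subset_circle_of_unitary hu hz
    have h3 : ‖f z‖ * ‖f z‖ = 1 := by rw [← norm_mul, hf, hz1]
    rw [hp z hz]
    have : star (f z) * f z = ((‖f z‖ * ‖f z‖ : ℝ) : ℂ) := by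
      have := Complex.conj_mul' (f z)
      push_cast
      rw [← sq]; exact this
    rw [this, h3]; simp
  · have := cfc_polynomial (R := ℂ) (p * p) u
    rw [← map_mul, ← this]
    conv_rhs => rw [← cfc_id ℂ u]
    refine cfc_congr fun z hz => ?_
    simp [hp z hz, hf]

/-- A unitary `n×n` complex matrix `u` is symmetric (`uᵀ = u`) if and only if there exists a
unitary matrix `v` with `u = v·vᵀ`. (Triviality of `H¹(ℤ/2; U(n))` for the conjugation
action.) -/
theorem stmt6 (n : ℕ) (hn : 1 ≤ n) (u : Matrix (Fin n) (Fin n) ℂ)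
    (hu : u ∈ Matrix.unitaryGroup (Fin n) ℂ) :
    u.transpose = u ↔
      ∃ v ∈ Matrix.unitaryGroup (Fin n) ℂ, u = v * v.transpose := by
  constructor
  · intro h
    obtain ⟨p, h1, h2⟩ := exists_sqrt_aux n u hu
    refine ⟨_, h1, ?_⟩
    have : (Polynomial.aeval u p).transpose = Polynomial.aeval u p := by
      rw [Polynomial.aeval_eq_sum_range, Matrix.transpose_sum]
      simp [Matrix.transpose_smul, Matrix.transpose_pow, h]
    rw [this, h2]
  · rintro ⟨v, -, rfl⟩
    simp [Matrix.transpose_mul]
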